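/- arXiv:1704.02453 — 2 statements merged into one kernel-verified Lean document; each statement's English description precedes it below -/
import Mathlib

section
/- Multi-Winner Approval Voting is the only ABC counting rule that satisfies disjoint equality: (1) the ABC counting rule implemented by f_AV(x,y) = x satisfies disjoint equality, and (2) every ABC counting rule F satisfying disjoint equality coincides with Multi-Winner Approval Voting, i.e., for every approval profile A and all committees W1, W2, W1 ≻_{F(A)} W2 if and only if score_{f_AV}(W1,A) > score_{f_AV}(W2,A). -/
namespace ABC

/-- An approval profile: a list of approval ballots (one per voter),
each ballot a subset of the candidate set `Fin m`. -/
abbrev Profile (m : ℕ) := List (Finset (Fin m))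

/-- `n`-fold concatenation of a profile with itself. -/
def nCopies {m : ℕ} (n : ℕ) (A : Profile m) : Profile m := (List.replicate n A).flatten

/-- A counting function `f : {0,…,k} × {0,…,m} → ℝ`, weakly increasing in the
first coordinate. -/
def IsCountingFunction (m k : ℕ) (f : ℕ → ℕ → ℝ) : Prop :=
  ∀ x x' y : ℕ, x' ≤ x → x ≤ k → y ≤ m → f x' y ≤ f x y

/-- The `f`-score of a committee `W` in a profile `A`. -/
noncomputable def score {m : ℕ} (f : ℕ → ℕ → ℝ) (W : Finset (Fin m)) (A : Profile m) : ℝ :=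
  (A.map (fun s => f (s ∩ W).card s.card)).sum

/-- An ABC ranking rule: a weak order (complete, transitive) on committees
(size-`k` subsets of the `m` candidates) for every approval profile. -/
structure ABCRankingRule (m k : ℕ) where
  rel : Profile m → Finset (Fin m) → Finset (Fin m) → Prop
  total : ∀ A W1 W2, W1.card = k → W2.card = k → rel A W1 W2 ∨ rel A W2 W1
  trans : ∀ A W1 W2 W3, W1.card = k → W2.card = k → W3.card = k →
    rel A W1 W2 → rel A W2 W3 → rel A W1 W3

/-- The strict part of a (weak) relation on committees. -/
def strictOf {ρ : Type} {m : ℕ} (rel : ρ → Finset (Fin m) → Finset (Fin m) → Prop)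
    (A : ρ) (W1 W2 : Finset (Fin m)) : Prop :=
  rel A W1 W2 ∧ ¬ rel A W2 W1

def ABCRankingRule.strict {m k : ℕ} (F : ABCRankingRule m k) :
    Profile m → Finset (Fin m) → Finset (Fin m) → Prop :=
  strictOf F.rel

/-- Anonymity: the outcome depends only on the multiset of ballots. -/
def Anonymous (m k : ℕ) (rel : Profile m → Finset (Fin m) → Finset (Fin m) → Prop) : Prop :=
  ∀ A A' : Profile m, A.Perm A' → ∀ W1 W2 : Finset (Fin m), W1.card = k → W2.card = k →
    (rel A W1 W2 ↔ rel A' W1 W2)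

/-- Neutrality: renaming candidates by a permutation renames the outcome accordingly. -/
def Neutral (m k : ℕ) (rel : Profile m → Finset (Fin m) → Finset (Fin m) → Prop) : Prop :=
  ∀ (σ : Equiv.Perm (Fin m)) (A : Profile m) (W1 W2 : Finset (Fin m)),
    W1.card = k → W2.card = k →
    (rel A W1 W2 ↔ rel (A.map (fun s => s.image σ)) (W1.image σ) (W2.image σ))

/-- Consistency for ABC ranking rules. -/
def Consistent (m k : ℕ) (rel : Profile m → Finset (Fin m) → Finset (Fin m) → Prop) : Prop :=
  ∀ (A A' : Profile m) (W1 W2 : Finset (Fin m)), W1.card = k → W2.card = k →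
    (strictOf rel A W1 W2 → rel A' W1 W2 → strictOf rel (A ++ A') W1 W2) ∧
    (rel A W1 W2 → rel A' W1 W2 → rel (A ++ A') W1 W2)

/-- Weak efficiency: if no voter approves any candidate of `W2 \ W1` then `W1 ⪰ W2`. -/
def WeakEfficient (m k : ℕ) (rel : Profile m → Finset (Fin m) → Finset (Fin m) → Prop) : Prop :=
  ∀ (A : Profile m) (W1 W2 : Finset (Fin m)), W1.card = k → W2.card = k →
    (∀ s ∈ A, ∀ c ∈ W2, c ∉ W1 → c ∉ s) → rel A W1 W2

/-- Efficiency: if every voter approves at least as many members of `W1` as of `W2`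
then `W1 ⪰ W2`. -/
def Efficient (m k : ℕ) (rel : Profile m → Finset (Fin m) → Finset (Fin m) → Prop) : Prop :=
  ∀ (A : Profile m) (W1 W2 : Finset (Fin m)), W1.card = k → W2.card = k →
    (∀ s ∈ A, (s ∩ W2).card ≤ (s ∩ W1).card) → rel A W1 W2

/-- Continuity for ABC ranking rules. -/
def Continuous (m k : ℕ) (rel : Profile m → Finset (Fin m) → Finset (Fin m) → Prop) : Prop :=
  ∀ (A A' : Profile m) (W1 W2 : Finset (Fin m)), W1.card = k → W2.card = k →
    strictOf rel A' W1 W2 → ∃ n : ℕ, strictOf rel (A ++ nCopies n A') W1 W2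

/-- A counting function `f` implements an ABC ranking rule `F`. -/
def Implements (m k : ℕ) (f : ℕ → ℕ → ℝ) (F : ABCRankingRule m k) : Prop :=
  ∀ (A : Profile m) (W1 W2 : Finset (Fin m)), W1.card = k → W2.card = k →
    (score f W2 A < score f W1 A ↔ F.strict A W1 W2)

/-- `F` is an ABC counting rule: some counting function implements it. -/
def IsCountingRule (m k : ℕ) (F : ABCRankingRule m k) : Prop :=
  ∃ f : ℕ → ℕ → ℝ, IsCountingFunction m k f ∧ Implements m k f F

/-- `W` is a winning committee in `F(A)`: it is a maximal element of the weak order. -/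
def Winning (m k : ℕ) (F : ABCRankingRule m k) (A : Profile m) (W : Finset (Fin m)) : Prop :=
  W.card = k ∧ ∀ W' : Finset (Fin m), W'.card = k → F.rel A W W'

/-- `A` is a party-list profile with `p` parties with approval sets `Cs 0, …, Cs (p-1)`:
the `Cs i` are pairwise disjoint nonempty sets, every ballot equals some `Cs i`,
and each party has at least one voter. -/
def IsPartyList (m : ℕ) (A : Profile m) (p : ℕ) (Cs : Fin p → Finset (Fin m)) : Prop :=
  (∀ i, (Cs i).Nonempty) ∧
  (∀ i j, i ≠ j → Disjoint (Cs i) (Cs j)) ∧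
  (∀ s ∈ A, ∃ i, s = Cs i) ∧
  (∀ i, Cs i ∈ A)

/-- The number `|N_i|` of voters of party `i`. -/
def partySize {m : ℕ} (A : Profile m) {p : ℕ} (Cs : Fin p → Finset (Fin m)) (i : Fin p) : ℕ :=
  A.count (Cs i)

/-- `W` is D'Hondt proportional for the party-list profile `A`:
for all parties `i, j`: `C_j ⊆ W`, or `W ∩ C_i = ∅`, or
`|N_i|/|W∩C_i| ≥ |N_j|/(|W∩C_j|+1)` (stated cross-multiplied). -/
def DHondtProportionalFor (m : ℕ) (A : Profile m) (p : ℕ) (Cs : Fin p → Finset (Fin m))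
    (W : Finset (Fin m)) : Prop :=
  ∀ i j : Fin p,
    Cs j ⊆ W ∨ W ∩ Cs i = ∅ ∨
    partySize A Cs j * (W ∩ Cs i).card ≤ partySize A Cs i * ((W ∩ Cs j).card + 1)

/-- D'Hondt proportionality for ABC ranking rules. -/
def DHondtProp (m k : ℕ) (F : ABCRankingRule m k) : Prop :=
  ∀ (A : Profile m) (p : ℕ) (Cs : Fin p → Finset (Fin m)), IsPartyList m A p Cs →
    ∀ W : Finset (Fin m), W.card = k →
      (Winning m k F A W ↔ DHondtProportionalFor m A p Cs W)

/-- The PAV counting function `f_PAV(x,y) = Σ_{i=1}^{x} 1/i`. -/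
noncomputable def fPAV : ℕ → ℕ → ℝ := fun x _ => ∑ i ∈ Finset.range x, (1 : ℝ) / (i + 1)

/-- The AV counting function `f_AV(x,y) = x`. -/
def fAV : ℕ → ℕ → ℝ := fun x _ => (x : ℝ)

/-- The Chamberlin–Courant counting function. -/
noncomputable def fCC : ℕ → ℕ → ℝ := fun x _ => if x = 0 then 0 else 1

/-- The union of all approval sets in a profile. -/
def profileUnion {m : ℕ} (A : Profile m) : Finset (Fin m) := A.foldr (· ∪ ·) ∅

/-- Disjoint equality for ABC ranking rules. -/
def DisjointEquality (m k : ℕ) (F : ABCRankingRule m k) : Prop :=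
  ∀ A : Profile m,
    (∀ c : Fin m, A.countP (fun s => decide (c ∈ s)) ≤ 1) →
    k ≤ (profileUnion A).card →
    ∀ W : Finset (Fin m), W.card = k →
      (Winning m k F A W ↔ W ⊆ profileUnion A)

/-- Disjoint diversity for ABC ranking rules, stated for party-list profiles whose
parties are indexed in order of weakly decreasing size. -/
def DisjointDiversity (m k : ℕ) (F : ABCRankingRule m k) : Prop :=
  ∀ (A : Profile m) (p : ℕ) (Cs : Fin p → Finset (Fin m)), IsPartyList m A p Cs →
    (∀ i j : Fin p, i ≤ j → partySize A Cs j ≤ partySize A Cs i) →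
    ∃ W : Finset (Fin m), Winning m k F A W ∧
      ∀ i : Fin p, (i : ℕ) < k → (W ∩ Cs i).Nonempty

/-- Lower quota for ABC ranking rules. -/
def LowerQuota (m k : ℕ) (F : ABCRankingRule m k) : Prop :=
  ∀ (A : Profile m) (p : ℕ) (Cs : Fin p → Finset (Fin m)), IsPartyList m A p Cs →
    ∀ W : Finset (Fin m), Winning m k F A W →
      ∀ i : Fin p,
        k * partySize A Cs i / A.length ≤ (W ∩ Cs i).card ∨
        (Cs i).card < k * partySize A Cs i / A.length

/-- A trivial ABC ranking rule declares all committees tied on all profiles. -/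
def IsTrivialRule (m k : ℕ) (F : ABCRankingRule m k) : Prop :=
  ∀ (A : Profile m) (W1 W2 : Finset (Fin m)), W1.card = k → W2.card = k → F.rel A W1 W2

/-- An `ℓ`-regular profile: every voter approves exactly `ℓ` candidates. -/
def IsRegular (m ℓ : ℕ) (A : Profile m) : Prop := ∀ s ∈ A, s.card = ℓ

/- ### Linear-order (LOC) profiles -/

/-- A profile of linear orders: each voter's ranking is a bijection sending a
candidate to its position (position `0` is the top). -/
abbrev LProfile (m : ℕ) := List (Fin m ≃ Fin m)

def nCopiesL {m : ℕ} (n : ℕ) (P : LProfile m) : LProfile m := (List.replicate n P).flatten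

/-- The set of a voter's top `ℓ` candidates. -/
def apprTop (m ℓ : ℕ) (r : Fin m ≃ Fin m) : Finset (Fin m) :=
  Finset.univ.filter (fun c => (r c : ℕ) < ℓ)

/-- `Appr(P, ℓ)`: the approval profile in which each voter approves her top `ℓ`
candidates. -/
def ApprProfile (m ℓ : ℕ) (P : LProfile m) : Profile m := P.map (apprTop m ℓ)

def LAnonymous (m k : ℕ) (rel : LProfile m → Finset (Fin m) → Finset (Fin m) → Prop) : Prop :=
  ∀ P P' : LProfile m, P.Perm P' → ∀ W1 W2 : Finset (Fin m), W1.card = k → W2.card = k →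
    (rel P W1 W2 ↔ rel P' W1 W2)

def LNeutral (m k : ℕ) (rel : LProfile m → Finset (Fin m) → Finset (Fin m) → Prop) : Prop :=
  ∀ (σ : Equiv.Perm (Fin m)) (P : LProfile m) (W1 W2 : Finset (Fin m)),
    W1.card = k → W2.card = k →
    (rel P W1 W2 ↔ rel (P.map (fun r => σ.symm.trans r)) (W1.image σ) (W2.image σ))

def LConsistent (m k : ℕ) (rel : LProfile m → Finset (Fin m) → Finset (Fin m) → Prop) : Prop :=
  ∀ (P P' : LProfile m) (W1 W2 : Finset (Fin m)), W1.card = k → W2.card = k →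
    (strictOf rel P W1 W2 → rel P' W1 W2 → strictOf rel (P ++ P') W1 W2) ∧
    (rel P W1 W2 → rel P' W1 W2 → rel (P ++ P') W1 W2)

def LContinuous (m k : ℕ) (rel : LProfile m → Finset (Fin m) → Finset (Fin m) → Prop) : Prop :=
  ∀ (P P' : LProfile m) (W1 W2 : Finset (Fin m)), W1.card = k → W2.card = k →
    strictOf rel P' W1 W2 → ∃ n : ℕ, strictOf rel (P ++ nCopiesL n P') W1 W2

/-- `I` dominates `J`: sorted increasingly, the `t`-th element of `I` is at most
the `t`-th element of `J`. -/
def dominatesPos (m : ℕ) (I J : Finset (Fin m)) : Prop :=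
  List.Forall₂ (· ≤ ·) (I.sort (· ≤ ·)) (J.sort (· ≤ ·))

/-- Committee dominance for LOC ranking rules. -/
def LCommitteeDominance (m k : ℕ)
    (rel : LProfile m → Finset (Fin m) → Finset (Fin m) → Prop) : Prop :=
  ∀ (P : LProfile m) (W1 W2 : Finset (Fin m)), W1.card = k → W2.card = k →
    (∀ r ∈ P, dominatesPos m (W1.image ⇑r) (W2.image ⇑r)) → rel P W1 W2

/- ### ABC choice rules -/

/-- An ABC choice rule: a nonempty set of winning committees for every profile. -/
structure ABCChoiceRule (m k : ℕ) where
  choice : Profile m → Set (Finset (Fin m))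
  nonempty : ∀ A, (choice A).Nonempty
  card_eq : ∀ A W, W ∈ choice A → W.card = k

def CAnonymous (m k : ℕ) (R : ABCChoiceRule m k) : Prop :=
  ∀ A A' : Profile m, A.Perm A' → R.choice A = R.choice A'

def CNeutral (m k : ℕ) (R : ABCChoiceRule m k) : Prop :=
  ∀ (σ : Equiv.Perm (Fin m)) (A : Profile m),
    R.choice (A.map (fun s => s.image σ)) = (fun W : Finset (Fin m) => W.image σ) '' R.choice A

def CConsistent (m k : ℕ) (R : ABCChoiceRule m k) : Prop :=
  ∀ A A' : Profile m, (R.choice A ∩ R.choice A').Nonempty →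
    R.choice (A ++ A') = R.choice A ∩ R.choice A'

def CContinuous (m k : ℕ) (R : ABCChoiceRule m k) : Prop :=
  ∀ A A' : Profile m, R.choice A ∩ R.choice A' = ∅ →
    ∃ n : ℕ, R.choice (A ++ nCopies n A') ⊆ R.choice A'

def CWeakEfficient (m k : ℕ) (R : ABCChoiceRule m k) : Prop :=
  ∀ (A : Profile m) (W : Finset (Fin m)), W ∈ R.choice A →
    ∀ c ∈ W, (∀ s ∈ A, c ∉ s) →
      ∀ c' : Fin m, c' ∉ W → insert c' (W.erase c) ∈ R.choice A

def TwoNonimposition (m k : ℕ) (R : ABCChoiceRule m k) : Prop :=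
  ∀ W1 W2 : Finset (Fin m), W1.card = k → W2.card = k →
    ∃ B : Profile m, R.choice B = {W1, W2}

/-- The ranking-side relation `F_R` induced by a choice rule `R` and a map `α`. -/
def relFR (m k : ℕ) (R : ABCChoiceRule m k)
    (α : Finset (Fin m) → Finset (Fin m) → Profile m)
    (A : Profile m) (W1 W2 : Finset (Fin m)) : Prop :=
  ∃ n : ℕ, ∀ n' ≥ n, W1 ∈ R.choice (A ++ nCopies n' (α W1 W2))

def CDHondtProp (m k : ℕ) (R : ABCChoiceRule m k) : Prop :=
  ∀ (A : Profile m) (p : ℕ) (Cs : Fin p → Finset (Fin m)), IsPartyList m A p Cs →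
    ∀ W : Finset (Fin m), W.card = k →
      (W ∈ R.choice A ↔ DHondtProportionalFor m A p Cs W)

def CDisjointDiversity (m k : ℕ) (R : ABCChoiceRule m k) : Prop :=
  ∀ (A : Profile m) (p : ℕ) (Cs : Fin p → Finset (Fin m)), IsPartyList m A p Cs →
    (∀ i j : Fin p, i ≤ j → partySize A Cs j ≤ partySize A Cs i) →
    ∃ W ∈ R.choice A, ∀ i : Fin p, (i : ℕ) < k → (W ∩ Cs i).Nonempty

/-- A trivial ABC choice rule returns all committees on every profile. -/
def CTrivial (m k : ℕ) (R : ABCChoiceRule m k) : Prop :=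
  ∀ A : Profile m, R.choice A = {W : Finset (Fin m) | W.card = k}


theorem mem_profileUnion {m : ℕ} {A : Profile m} {c : Fin m} :
    c ∈ profileUnion A ↔ ∃ s ∈ A, c ∈ s := by
  induction A with
  | nil => simp [profileUnion]
  | cons s A ih =>
    have h : profileUnion (s :: A) = s ∪ profileUnion A := rfl
    simp [h, ih]

theorem score_cons {m : ℕ} (f : ℕ → ℕ → ℝ) (W s : Finset (Fin m)) (A : Profile m) :
    score f W (s :: A) = f (s ∩ W).card s.card + score f W A := by
  simp [score]

theorem score_fAV_eq_sum_countP {m : ℕ} (W : Finset (Fin m)) (A : Profile m) :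
    score fAV W A = ∑ c ∈ W, (A.countP (fun s => decide (c ∈ s)) : ℝ) := by
  induction A with
  | nil => simp [score]
  | cons s A ih =>
    have h : ((s ∩ W).card : ℝ) = ∑ c ∈ W, if c ∈ s then (1 : ℝ) else 0 := by
      rw [Finset.sum_boole, Finset.filter_mem_eq_inter, Finset.inter_comm]
    rw [score_cons, ih, fAV, h, ← Finset.sum_add_distrib]
    refine Finset.sum_congr rfl fun c _ => ?_
    by_cases hc : c ∈ s <;> simp [hc, add_comm]

/-- When no candidate is approved twice, the approval score of `W` is the number of members of
`W` that are approved by some voter. -/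
theorem score_fAV_of_countP_le_one {m : ℕ} {A : Profile m}
    (hA : ∀ c : Fin m, A.countP (fun s => decide (c ∈ s)) ≤ 1) (W : Finset (Fin m)) :
    score fAV W A = (W ∩ profileUnion A).card := by
  rw [score_fAV_eq_sum_countP, ← Finset.filter_mem_eq_inter, ← Finset.sum_boole]
  refine Finset.sum_congr rfl fun c _ => ?_
  have hpos : 0 < A.countP (fun s => decide (c ∈ s)) ↔ c ∈ profileUnion A := by
    simp [List.countP_pos_iff, mem_profileUnion]
  split_ifs with hc
  · have h := hpos.2 hc
    exact_mod_cast le_antisymm (hA c) h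
  · have h := mt hpos.1 hc
    exact_mod_cast Nat.eq_zero_of_not_pos h

theorem Implements.rel_iff {m k : ℕ} {f : ℕ → ℕ → ℝ} {F : ABCRankingRule m k}
    (hF : Implements m k f F) (A : Profile m) {W₁ W₂ : Finset (Fin m)}
    (h₁ : W₁.card = k) (h₂ : W₂.card = k) :
    F.rel A W₁ W₂ ↔ score f W₂ A ≤ score f W₁ A := by
  rw [← not_lt, hF A W₂ W₁ h₂ h₁, ABCRankingRule.strict, strictOf]
  have := F.total A W₁ W₂ h₁ h₂
  tauto

theorem Implements.winning_iff {m k : ℕ} {f : ℕ → ℕ → ℝ} {F : ABCRankingRule m k}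
    (hF : Implements m k f F) (A : Profile m) {W : Finset (Fin m)} (hW : W.card = k) :
    Winning m k F A W ↔ ∀ W' : Finset (Fin m), W'.card = k → score f W' A ≤ score f W A := by
  refine ⟨fun h W' hW' => (hF.rel_iff A hW hW').1 (h.2 W' hW'),
    fun h => ⟨hW, fun W' hW' => (hF.rel_iff A hW hW').2 (h W' hW')⟩⟩

theorem disjointEquality_of_implements_fAV {m k : ℕ} {F : ABCRankingRule m k}
    (hF : Implements m k fAV F) : DisjointEquality m k F := by
  intro A hA hk W hW
  simp only [hF.winning_iff A hW, score_fAV_of_countP_le_one hA, Nat.cast_le]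
  constructor
  · intro h
    obtain ⟨W', hsub, hW'⟩ := Finset.exists_subset_card_eq hk
    have hle := h W' hW'
    rw [Finset.inter_eq_left.2 hsub, hW', ← hW] at hle
    exact Finset.inter_eq_left.1 (Finset.eq_of_subset_of_card_le Finset.inter_subset_left hle)
  · intro h W' hW'
    rw [Finset.inter_eq_left.2 h, hW, ← hW']
    exact Finset.card_le_card Finset.inter_subset_left

/-- The profile with one ballot `{c}` for each `c ∈ S`. -/
noncomputable def singletonProfile {m : ℕ} (S : Finset (Fin m)) : Profile m :=
  S.toList.map fun c => {c}

theorem profileUnion_singletonProfile {m : ℕ} (S : Finset (Fin m)) :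
    profileUnion (singletonProfile S) = S := by
  ext c
  simp [mem_profileUnion, singletonProfile]

theorem countP_singletonProfile {m : ℕ} (S : Finset (Fin m)) (c : Fin m) :
    (singletonProfile S).countP (fun s => decide (c ∈ s)) = if c ∈ S then 1 else 0 := by
  have h : (singletonProfile S).countP (fun s => decide (c ∈ s)) = S.toList.count c := by
    rw [singletonProfile, List.countP_map, List.count]
    congr 1
    ext x
    rw [Bool.eq_iff_iff]
    simp only [Function.comp_apply, Finset.mem_singleton, decide_eq_true_eq, beq_iff_eq]
    exact eq_comm
  rw [h, S.nodup_toList.count]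
  simp

theorem score_singletonProfile {m : ℕ} (f : ℕ → ℕ → ℝ) (W S : Finset (Fin m)) :
    score f W (singletonProfile S) = S.card * f 0 1 + (S ∩ W).card * (f 1 1 - f 0 1) := by
  have h : score f W (singletonProfile S) = ∑ c ∈ S, f ({c} ∩ W).card 1 := by
    rw [score, singletonProfile, List.map_map, ← Finset.sum_map_toList]
    rfl
  have h' : ∀ c ∈ S,
      f ({c} ∩ W).card 1 = f 0 1 + (if c ∈ W then 1 else 0) * (f 1 1 - f 0 1) := by
    intro c _
    by_cases hc : c ∈ W <;> simp [hc]
  rw [h, Finset.sum_congr rfl h', Finset.sum_add_distrib, ← Finset.sum_mul, Finset.sum_boole,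
    Finset.filter_mem_eq_inter]
  simp

theorem DisjointEquality.marginal_pos {m k : ℕ} (hk : 0 < k) (hkm : k < m) {f : ℕ → ℕ → ℝ}
    {F : ABCRankingRule m k} (hF : Implements m k f F) (hD : DisjointEquality m k F) :
    0 < f 1 1 - f 0 1 := by
  obtain ⟨S, -, hS⟩ := Finset.exists_subset_card_eq
    (show k ≤ (Finset.univ : Finset (Fin m)).card by simpa using hkm.le)
  obtain ⟨c, hc⟩ : ∃ c, c ∉ S := by
    by_contra! h
    have := congrArg Finset.card (Finset.eq_univ_iff_forall.2 h)
    simp only [Finset.card_univ, Fintype.card_fin] at this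
    omega
  obtain ⟨b, hb⟩ : S.Nonempty := Finset.card_pos.1 (hS ▸ hk)
  set W := insert c (S.erase b) with hWdef
  have hW : W.card = k := by
    rw [hWdef, Finset.card_insert_of_notMem (fun h => hc (Finset.mem_of_mem_erase h)),
      Finset.card_erase_of_mem hb]
    omega
  have hwin := hD (singletonProfile S)
    (fun c => by rw [countP_singletonProfile]; split_ifs <;> simp)
    (by rw [profileUnion_singletonProfile, hS])
  rw [profileUnion_singletonProfile] at hwin
  have hSwin := (hF.winning_iff _ hS).1 ((hwin S hS).2 subset_rfl)
  have hWlose : ¬ Winning m k F (singletonProfile S) W := fun h =>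
    hc ((hwin W hW).1 h (Finset.mem_insert_self _ _))
  rw [hF.winning_iff _ hW] at hWlose
  push Not at hWlose
  obtain ⟨W', hW', hlt⟩ := hWlose
  have hlt' := hlt.trans_le (hSwin W' hW')
  simp only [score_singletonProfile, Finset.inter_self] at hlt'
  have hle : ((S ∩ W).card : ℝ) ≤ S.card :=
    Nat.cast_le.2 (Finset.card_le_card Finset.inter_subset_left)
  nlinarith

/-- Under disjoint equality, `f` is affine in the number of approved committee members on every
ballot, with a slope that does not depend on the ballot. -/
theorem DisjointEquality.sub_eq {m k : ℕ} {f : ℕ → ℕ → ℝ}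
    {F : ABCRankingRule m k} (hF : Implements m k f F) (hD : DisjointEquality m k F)
    (s : Finset (Fin m)) {W₁ W₂ : Finset (Fin m)} (h₁ : W₁.card = k) (h₂ : W₂.card = k) :
    f (s ∩ W₁).card s.card - f (s ∩ W₂).card s.card =
      (f 1 1 - f 0 1) * ((s ∩ W₁).card - (s ∩ W₂).card) := by
  have hU : profileUnion (s :: singletonProfile sᶜ) = Finset.univ := by
    have h : profileUnion (s :: singletonProfile sᶜ) = s ∪ profileUnion (singletonProfile sᶜ) :=
      rfl
    rw [h, profileUnion_singletonProfile, Finset.union_compl]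
  have hwin : ∀ W : Finset (Fin m), W.card = k →
      Winning m k F (s :: singletonProfile sᶜ) W := by
    intro W hW
    refine (hD _ (fun c => ?_) ?_ W hW).2 (hU ▸ Finset.subset_univ W)
    · rw [List.countP_cons, countP_singletonProfile]
      by_cases hc : c ∈ s <;> simp [hc]
    · rw [hU, ← hW]
      exact Finset.card_le_card (Finset.subset_univ W)
  have heq := le_antisymm ((hF.winning_iff _ h₂).1 (hwin W₂ h₂) W₁ h₁)
    ((hF.winning_iff _ h₁).1 (hwin W₁ h₁) W₂ h₂)
  have hcard : ∀ W : Finset (Fin m), W.card = k →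
      ((sᶜ ∩ W).card : ℝ) = k - (s ∩ W).card := by
    intro W hW
    rw [Finset.inter_comm sᶜ, ← Finset.sdiff_eq_inter_compl, ← hW,
      ← Finset.card_sdiff_add_card_inter W s, Finset.inter_comm s]
    push_cast
    ring
  rw [score_cons, score_cons, score_singletonProfile, score_singletonProfile, hcard W₁ h₁,
    hcard W₂ h₂] at heq
  linarith

theorem DisjointEquality.score_sub_eq {m k : ℕ} {f : ℕ → ℕ → ℝ}
    {F : ABCRankingRule m k} (hF : Implements m k f F) (hD : DisjointEquality m k F)
    (A : Profile m) {W₁ W₂ : Finset (Fin m)} (h₁ : W₁.card = k) (h₂ : W₂.card = k) :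
    score f W₁ A - score f W₂ A =
      (f 1 1 - f 0 1) * (score fAV W₁ A - score fAV W₂ A) := by
  induction A with
  | nil => simp [score]
  | cons s A ih =>
    have h := hD.sub_eq hF s h₁ h₂
    simp only [score_cons, fAV] at ih ⊢
    linarith

/-- Multi-Winner Approval Voting is the only ABC counting rule
satisfying disjoint equality. -/
theorem statement6 (m k : ℕ) (hk : 0 < k) (hkm : k < m) :
    (∀ F : ABCRankingRule m k, Implements m k fAV F → DisjointEquality m k F) ∧
    (∀ F : ABCRankingRule m k, IsCountingRule m k F → DisjointEquality m k F →
      ∀ (A : Profile m) (W1 W2 : Finset (Fin m)), W1.card = k → W2.card = k →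
        (F.strict A W1 W2 ↔ score fAV W2 A < score fAV W1 A)) := by
  refine ⟨fun F hF => disjointEquality_of_implements_fAV hF, ?_⟩
  rintro F ⟨f, -, hF⟩ hD A W1 W2 h1 h2
  have hpos := hD.marginal_pos hk hkm hF
  have hsub := hD.score_sub_eq hF A h1 h2
  rw [← hF A W1 W2 h1 h2, ← sub_pos, hsub, mul_pos_iff_of_pos_left hpos, sub_pos]

end ABC
end

section
/- Let F be an ABC ranking rule satisfying anonymity, consistency, and continuity. Let W1, W2 be committees and let P, Q be approval profiles with W2 ≻_{F(P)} W1 and W1 ≻_{F(Q)} W2. For x ∈ ℕ (x ≥ 0) and y ∈ ℕ (y ≥ 1), let S(x,y) = xP + yQ. Then the set T = { x/y : x ≥ 0, y ≥ 1, W1 ≻_{F(S(x,y))} W2 } is nonempty and bounded above, and its supremum t* is a positive real number; moreover, for all x ≥ 0 and y ≥ 1: if x/y < t* then W1 ≻_{F(S(x,y))} W2, and if x/y > t* then W2 ≻_{F(S(x,y))} W1. -/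
namespace ABC

theorem nCopies_add {m : ℕ} (a b : ℕ) (A : Profile m) :
    nCopies (a + b) A = nCopies a A ++ nCopies b A := by
  simp only [nCopies, List.replicate_add, List.flatten_append]

theorem nCopies_zero {m : ℕ} (A : Profile m) : nCopies 0 A = [] := by simp [nCopies]

theorem nCopies_one {m : ℕ} (A : Profile m) : nCopies 1 A = A := by simp [nCopies]

theorem mix_perm {m : ℕ} (P Q : Profile m) (x y x' y' : ℕ) :
    ((nCopies x P ++ nCopies y Q) ++ (nCopies x' P ++ nCopies y' Q)).Perm
      (nCopies (x + x') P ++ nCopies (y + y') Q) := by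
  rw [← Multiset.coe_eq_coe]
  simp only [nCopies_add, ← Multiset.coe_add]
  abel

section Mix

variable {m k : ℕ} {rel : Profile m → Finset (Fin m) → Finset (Fin m) → Prop}
  {W1 W2 : Finset (Fin m)}

theorem strictOf_perm (hA : Anonymous m k rel) (hW1 : W1.card = k) (hW2 : W2.card = k)
    {A A' : Profile m} (h : A.Perm A') (hs : strictOf rel A W1 W2) : strictOf rel A' W1 W2 :=
  ⟨(hA A A' h W1 W2 hW1 hW2).1 hs.1, fun h' => hs.2 ((hA A A' h W2 W1 hW2 hW1).2 h')⟩

theorem rel_mix_add (hA : Anonymous m k rel) (hC : Consistent m k rel)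
    (hW1 : W1.card = k) (hW2 : W2.card = k) {P Q : Profile m} {x y x' y' : ℕ}
    (h : rel (nCopies x P ++ nCopies y Q) W1 W2)
    (h' : rel (nCopies x' P ++ nCopies y' Q) W1 W2) :
    rel (nCopies (x + x') P ++ nCopies (y + y') Q) W1 W2 :=
  (hA _ _ (mix_perm P Q x y x' y') W1 W2 hW1 hW2).1 ((hC _ _ W1 W2 hW1 hW2).2 h h')

theorem strictOf_mix_add (hA : Anonymous m k rel) (hC : Consistent m k rel)
    (hW1 : W1.card = k) (hW2 : W2.card = k) {P Q : Profile m} {x y x' y' : ℕ}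
    (h : strictOf rel (nCopies x P ++ nCopies y Q) W1 W2)
    (h' : rel (nCopies x' P ++ nCopies y' Q) W1 W2) :
    strictOf rel (nCopies (x + x') P ++ nCopies (y + y') Q) W1 W2 :=
  strictOf_perm hA hW1 hW2 (mix_perm P Q x y x' y') ((hC _ _ W1 W2 hW1 hW2).1 h h')

theorem rel_mix_mul (hA : Anonymous m k rel) (hC : Consistent m k rel)
    (hW1 : W1.card = k) (hW2 : W2.card = k) {P Q : Profile m} {x y n : ℕ} (hn : 1 ≤ n)
    (h : rel (nCopies x P ++ nCopies y Q) W1 W2) :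
    rel (nCopies (n * x) P ++ nCopies (n * y) Q) W1 W2 := by
  induction n, hn using Nat.le_induction with
  | base => simpa using h
  | succ n _ ih =>
    rw [Nat.succ_mul, Nat.succ_mul]
    exact rel_mix_add hA hC hW1 hW2 ih h

theorem strictOf_mix_mul (hA : Anonymous m k rel) (hC : Consistent m k rel)
    (hW1 : W1.card = k) (hW2 : W2.card = k) {P Q : Profile m} {x y n : ℕ} (hn : 1 ≤ n)
    (h : strictOf rel (nCopies x P ++ nCopies y Q) W1 W2) :
    strictOf rel (nCopies (n * x) P ++ nCopies (n * y) Q) W1 W2 := by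
  induction n, hn using Nat.le_induction with
  | base => simpa using h
  | succ n _ ih =>
    rw [Nat.succ_mul, Nat.succ_mul]
    exact strictOf_mix_add hA hC hW1 hW2 ih h.1

theorem not_rel_mix_of_le (hA : Anonymous m k rel) (hC : Consistent m k rel)
    (hW1 : W1.card = k) (hW2 : W2.card = k) {P Q : Profile m}
    (hP : rel P W2 W1) {x y x' y' : ℕ} (hy : 1 ≤ y) (hy' : 1 ≤ y')
    (hle : x' * y ≤ x * y') (h : strictOf rel (nCopies x P ++ nCopies y Q) W1 W2) :
    ¬ rel (nCopies x' P ++ nCopies y' Q) W2 W1 := by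
  intro hr
  refine (strictOf_mix_mul hA hC hW1 hW2 hy' h).2 ?_
  have hr' := rel_mix_mul hA hC hW2 hW1 hy hr
  obtain ⟨d, hd⟩ := Nat.exists_eq_add_of_le hle
  rw [mul_comm y' x, hd, mul_comm x' y, mul_comm y' y]
  rcases Nat.eq_zero_or_pos d with rfl | hd0
  · exact hr'
  · have hPd : rel (nCopies (d * 1) P ++ nCopies (d * 0) Q) W2 W1 :=
      rel_mix_mul hA hC hW2 hW1 hd0 (by simpa [nCopies_zero, nCopies_one] using hP)
    simpa using rel_mix_add hA hC hW2 hW1 hr' hPd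

end Mix

/-- the threshold lemma. For profiles `P`, `Q` with
`W2 ≻_{F(P)} W1` and `W1 ≻_{F(Q)} W2`, the set
`T = { x/y : W1 ≻_{F(xP + yQ)} W2 }` is nonempty and bounded above, its
supremum `t*` is positive, and `x/y < t*` forces `W1 ≻ W2` while `x/y > t*`
forces `W2 ≻ W1` in `F(xP + yQ)`. -/
theorem statement9 (m k : ℕ) (hk : 0 < k) (hkm : k < m) (F : ABCRankingRule m k)
    (hA : Anonymous m k F.rel) (hC : Consistent m k F.rel)
    (hCont : Continuous m k F.rel)
    (W1 W2 : Finset (Fin m)) (hW1 : W1.card = k) (hW2 : W2.card = k)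
    (P Q : Profile m) (hP : F.strict P W2 W1) (hQ : F.strict Q W1 W2)
    (T : Set ℝ)
    (hT : T = {r : ℝ | ∃ x y : ℕ, 1 ≤ y ∧ r = (x : ℝ) / (y : ℝ) ∧
      F.strict (nCopies x P ++ nCopies y Q) W1 W2}) :
    T.Nonempty ∧ BddAbove T ∧ 0 < sSup T ∧
      ∀ x y : ℕ, 1 ≤ y →
        ((x : ℝ) / (y : ℝ) < sSup T → F.strict (nCopies x P ++ nCopies y Q) W1 W2) ∧
        (sSup T < (x : ℝ) / (y : ℝ) → F.strict (nCopies x P ++ nCopies y Q) W2 W1) := by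
  have strict_of_not : ∀ {A U V}, U.card = k → V.card = k → ¬ F.rel A V U → F.strict A U V :=
    fun {A U V} hU hV h => ⟨(F.total A U V hU hV).resolve_right h, h⟩
  have hQ1 : F.strict (nCopies 0 P ++ nCopies 1 Q) W1 W2 := by
    simpa [nCopies_zero, nCopies_one] using hQ
  have anti : ∀ {x y x' y' : ℕ}, 1 ≤ y → 1 ≤ y' → (x' : ℝ) / y' ≤ (x : ℝ) / y →
      F.strict (nCopies x P ++ nCopies y Q) W1 W2 →
      F.strict (nCopies x' P ++ nCopies y' Q) W1 W2 := by
    intro x y x' y' hy hy' hle h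
    have hy0 : (0 : ℝ) < y := by exact_mod_cast hy
    have hy0' : (0 : ℝ) < y' := by exact_mod_cast hy'
    rw [div_le_div_iff₀ hy0' hy0] at hle
    exact strict_of_not hW1 hW2
      (not_rel_mix_of_le hA hC hW1 hW2 hP.1 hy hy' (by exact_mod_cast hle) h)
  have hmem : ∀ {x y : ℕ}, 1 ≤ y → F.strict (nCopies x P ++ nCopies y Q) W1 W2 →
      (x : ℝ) / y ∈ T := by
    intro x y hy h
    rw [hT]
    exact ⟨x, y, hy, rfl, h⟩
  have hne : T.Nonempty := ⟨_, hmem le_rfl hQ1⟩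
  obtain ⟨a, ha⟩ := hCont P Q W1 W2 hW1 hW2 hQ
  obtain ⟨b, hb⟩ := hCont Q P W2 W1 hW2 hW1 hP
  have ha1 : 1 ≤ a := by
    rcases Nat.eq_zero_or_pos a with rfl | h
    · exact absurd hP.1 (by simpa [nCopies_zero] using ha.2)
    · exact h
  have hb' : F.rel (nCopies b P ++ nCopies 1 Q) W2 W1 :=
    (hA _ _ (by rw [nCopies_one]; exact List.perm_append_comm) W2 W1 hW2 hW1).1 hb.1
  have hbdd : BddAbove T := by
    refine ⟨b, fun r hr => ?_⟩
    rw [hT] at hr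
    obtain ⟨x, y, hy, rfl, h⟩ := hr
    by_contra! hlt
    exact (anti hy le_rfl (by simpa using hlt.le) h).2 hb'
  have hpos : 0 < sSup T := by
    have haT : ((1 : ℕ) : ℝ) / a ∈ T := hmem ha1 (by rw [nCopies_one]; exact ha)
    have ha0 : (0 : ℝ) < a := by exact_mod_cast ha1
    exact lt_of_lt_of_le (by positivity) (le_csSup hbdd haT)
  refine ⟨hne, hbdd, hpos, fun x y hy => ⟨fun hlt => ?_, fun hlt => ?_⟩⟩
  · obtain ⟨r, hr, hxr⟩ := exists_lt_of_lt_csSup hne hlt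
    rw [hT] at hr
    obtain ⟨x', y', hy', rfl, h⟩ := hr
    exact anti hy' hy hxr.le h
  · refine strict_of_not hW2 hW1 fun hr => ?_
    have hy0 : (0 : ℝ) < y := by exact_mod_cast hy
    rw [lt_div_iff₀ hy0] at hlt
    obtain ⟨n, hn⟩ := exists_nat_gt (sSup T / (x - sSup T * y))
    have hd : 0 < (x : ℝ) - sSup T * y := sub_pos.2 hlt
    have hn0 : (0 : ℝ) < n := lt_trans (div_pos hpos hd) hn
    rw [div_lt_iff₀ hd] at hn
    have hs := strictOf_mix_add hA hC hW1 hW2 hQ1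
      (rel_mix_mul hA hC hW1 hW2 (n := n) (by exact_mod_cast hn0) hr)
    have hle := le_csSup hbdd (hmem (by omega) hs)
    push_cast at hle
    rw [div_le_iff₀ (by positivity)] at hle
    nlinarith

end ABC
end
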